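/- The embedding distance d_E is a metric on networks modulo isomorphism: for all networks N_X, N_Y, N_Z, (i) d_E(N_X, N_Y) ≥ 0; (ii) d_E(N_X, N_Y) = d_E(N_Y, N_X); (iii) d_E(N_X, N_Y) = 0 if and only if N_X and N_Y are isomorphic; and (iv) d_E(N_X, N_Y) ≤ d_E(N_X, N_Z) + d_E(N_Z, N_Y). -/

import Mathlib

open scoped BigOperators

/-- Network difference of a map `φ : X → Y` between networks `(X, rX)` and `(Y, rY)`:
`Δ_{X,Y}(φ) = max_{x,x'} |rX x x' - rY (φ x) (φ x')|`. -/
noncomputable def netDiff {X Y : Type*} (rX : X → X → ℝ)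
    (rY : Y → Y → ℝ) (φ : X → Y) : ℝ :=
  ⨆ x : X, ⨆ x' : X, |rX x x' - rY (φ x) (φ x')|

/-- Partial embedding distance `d_PE(N_X, N_Y) = min_{φ : X → Y} Δ_{X,Y}(φ)`. -/
noncomputable def dPE {X Y : Type*} (rX : X → X → ℝ) (rY : Y → Y → ℝ) : ℝ :=
  ⨅ φ : X → Y, netDiff rX rY φ

/-- Embedding distance `d_E(N_X, N_Y) = max {d_PE(N_X, N_Y), d_PE(N_Y, N_X)}`. -/
noncomputable def dE {X Y : Type*} (rX : X → X → ℝ) (rY : Y → Y → ℝ) : ℝ :=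
  max (dPE rX rY) (dPE rY rX)

theorem netDiff_le_iff {X Y : Type*} [Finite X] [Nonempty X] {rX : X → X → ℝ}
    {rY : Y → Y → ℝ} {φ : X → Y} {c : ℝ} :
    netDiff rX rY φ ≤ c ↔ ∀ x x', |rX x x' - rY (φ x) (φ x')| ≤ c := by
  unfold netDiff
  rw [ciSup_le_iff (Set.finite_range _).bddAbove]
  exact forall_congr' fun x => ciSup_le_iff (Set.finite_range _).bddAbove

theorem abs_sub_le_netDiff {X Y : Type*} [Finite X] [Nonempty X] (rX : X → X → ℝ)
    (rY : Y → Y → ℝ) (φ : X → Y) (x x' : X) :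
    |rX x x' - rY (φ x) (φ x')| ≤ netDiff rX rY φ :=
  netDiff_le_iff.1 le_rfl x x'

theorem netDiff_nonneg {X Y : Type*} (rX : X → X → ℝ) (rY : Y → Y → ℝ) (φ : X → Y) :
    0 ≤ netDiff rX rY φ :=
  Real.iSup_nonneg fun _ => Real.iSup_nonneg fun _ => abs_nonneg _

theorem dPE_nonneg {X Y : Type*} (rX : X → X → ℝ) (rY : Y → Y → ℝ) : 0 ≤ dPE rX rY :=
  Real.iInf_nonneg fun φ => netDiff_nonneg rX rY φ

theorem dPE_le_netDiff {X Y : Type*} (rX : X → X → ℝ) (rY : Y → Y → ℝ) (φ : X → Y) :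
    dPE rX rY ≤ netDiff rX rY φ :=
  ciInf_le ⟨0, by rintro _ ⟨ψ, rfl⟩; exact netDiff_nonneg rX rY ψ⟩ φ

/-- The infimum defining the partial embedding distance of finite networks is attained. -/
theorem exists_netDiff_eq_dPE {X Y : Type*} [Finite X] [Finite Y] [Nonempty Y]
    (rX : X → X → ℝ) (rY : Y → Y → ℝ) : ∃ φ : X → Y, netDiff rX rY φ = dPE rX rY :=
  exists_eq_ciInf_of_finite

theorem dPE_triangle {X Y Z : Type*} [Finite X] [Nonempty X] [Finite Y] [Nonempty Y]
    [Finite Z] [Nonempty Z] (rX : X → X → ℝ) (rY : Y → Y → ℝ) (rZ : Z → Z → ℝ) :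
    dPE rX rY ≤ dPE rX rZ + dPE rZ rY := by
  obtain ⟨φ, hφ⟩ := exists_netDiff_eq_dPE rX rZ
  obtain ⟨ψ, hψ⟩ := exists_netDiff_eq_dPE rZ rY
  rw [← hφ, ← hψ]
  refine (dPE_le_netDiff rX rY (ψ ∘ φ)).trans (netDiff_le_iff.2 fun x x' => ?_)
  exact (abs_sub_le _ (rZ (φ x) (φ x')) _).trans
    (add_le_add (abs_sub_le_netDiff rX rZ φ x x') (abs_sub_le_netDiff rZ rY ψ (φ x) (φ x')))

theorem dPE_eq_zero_iff {X Y : Type*} [Finite X] [Nonempty X] [Finite Y] [Nonempty Y]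
    {rX : X → X → ℝ} {rY : Y → Y → ℝ} :
    dPE rX rY = 0 ↔ ∃ φ : X → Y, ∀ x x', rX x x' = rY (φ x) (φ x') := by
  constructor
  · intro h
    obtain ⟨φ, hφ⟩ := exists_netDiff_eq_dPE rX rY
    refine ⟨φ, fun x x' => sub_eq_zero.1 (abs_nonpos_iff.1 ?_)⟩
    exact (abs_sub_le_netDiff rX rY φ x x').trans (hφ.trans h).le
  · rintro ⟨φ, hφ⟩
    refine le_antisymm ((dPE_le_netDiff rX rY φ).trans (netDiff_le_iff.2 fun x x' => ?_))
      (dPE_nonneg rX rY)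
    simp [hφ x x']

theorem injective_of_map_eq {X Y : Type*} {rX : X → X → ℝ} {rY : Y → Y → ℝ}
    (hX : ∀ x x', rX x x' = 0 → x = x') (hY : ∀ y, rY y y = 0) {φ : X → Y}
    (hφ : ∀ x x', rX x x' = rY (φ x) (φ x')) : Function.Injective φ :=
  fun x x' h => hX x x' (by rw [hφ, h, hY])

theorem dE_eq_zero_iff {X Y : Type*} [Finite X] [Nonempty X] [Finite Y] [Nonempty Y]
    {rX : X → X → ℝ} {rY : Y → Y → ℝ} (hX : ∀ x x', rX x x' = 0 ↔ x = x')
    (hY : ∀ y y', rY y y' = 0 ↔ y = y') :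
    dE rX rY = 0 ↔
      ∃ φ : X → Y, Function.Bijective φ ∧ ∀ x x', rX x x' = rY (φ x) (φ x') := by
  constructor
  · intro h
    have hXY : dPE rX rY = 0 := le_antisymm ((le_max_left _ _).trans h.le) (dPE_nonneg _ _)
    have hYX : dPE rY rX = 0 := le_antisymm ((le_max_right _ _).trans h.le) (dPE_nonneg _ _)
    obtain ⟨φ, hφ⟩ := dPE_eq_zero_iff.1 hXY
    obtain ⟨ψ, hψ⟩ := dPE_eq_zero_iff.1 hYX
    have hφi := injective_of_map_eq (fun x x' => (hX x x').1) (fun y => (hY y y).2 rfl) hφ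
    have hψi := injective_of_map_eq (fun y y' => (hY y y').1) (fun x => (hX x x).2 rfl) hψ
    have hcard : Nat.card X = Nat.card Y :=
      le_antisymm (Nat.card_le_card_of_injective φ hφi) (Nat.card_le_card_of_injective ψ hψi)
    exact ⟨φ, (Nat.bijective_iff_injective_and_card φ).2 ⟨hφi, hcard⟩, hφ⟩
  · rintro ⟨φ, hbij, hφ⟩
    have hXY : dPE rX rY = 0 := dPE_eq_zero_iff.2 ⟨φ, hφ⟩
    have hYX : dPE rY rX = 0 := by
      obtain ⟨ψ, -, hψ⟩ := Function.bijective_iff_has_inverse.1 hbij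
      exact dPE_eq_zero_iff.2 ⟨ψ, fun y y' => by rw [hφ, hψ, hψ]⟩
    simp [dE, hXY, hYX]

/-- the embedding distance is a metric modulo isomorphism. -/
theorem embedding_distance_is_metric
    {X Y Z : Type*} [Fintype X] [Nonempty X] [Fintype Y] [Nonempty Y]
    [Fintype Z] [Nonempty Z]
(rX : X → X → ℝ) (rY : Y → Y → ℝ)
    (hX0 : ∀ x x', 0 ≤ rX x x') (hXsymm : ∀ x x', rX x x' = rX x' x)
    (hXid : ∀ x x', rX x x' = 0 ↔ x = x')
    (hY0 : ∀ y y', 0 ≤ rY y y') (hYsymm : ∀ y y', rY y y' = rY y' y)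
    (hYid : ∀ y y', rY y y' = 0 ↔ y = y')
    (rZ : Z → Z → ℝ)
    (hZ0 : ∀ z z', 0 ≤ rZ z z') (hZsymm : ∀ z z', rZ z z' = rZ z' z)
    (hZid : ∀ z z', rZ z z' = 0 ↔ z = z') :
    0 ≤ dE rX rY ∧
    dE rX rY = dE rY rX ∧
    (dE rX rY = 0 ↔
      ∃ φ : X → Y, Function.Bijective φ ∧ ∀ x x', rX x x' = rY (φ x) (φ x')) ∧
    dE rX rY ≤ dE rX rZ + dE rZ rY := by
  refine ⟨(dPE_nonneg rX rY).trans (le_max_left _ _), max_comm _ _,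
    dE_eq_zero_iff hXid hYid, max_le ?_ ?_⟩
  · exact (dPE_triangle rX rY rZ).trans (add_le_add (le_max_left _ _) (le_max_left _ _))
  · rw [add_comm]
    exact (dPE_triangle rY rX rZ).trans (add_le_add (le_max_right _ _) (le_max_right _ _))
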